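/- (Main theorem) Two planted graphs (G,B) and (H,C) on the same vertex set V have the same cotransversal matroid (i.e. exactly the same routable sets) if and only if their saturations (G,B)̅ and (H,C)̅ can be obtained from each other by a finite sequence of swap operations. -/

import Mathlib

/-- `(G, B)` (with edge relation `E`) is a planted graph: `G` has no loops
(and, being given by a relation, no parallel edges) and every vertex of `B`
is a sink of `G`. -/
def IsPlanted {V : Type*} (E : V → V → Prop) (B : Finset V) : Prop :=
  (∀ v, ¬ E v v) ∧ ∀ b ∈ B, ∀ v, ¬ E b v

/-- `A` is routable to `B` in the directed graph with edge relation `E`: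
there is a family of pairwise vertex-disjoint directed paths (one ending at each
vertex of `B`, possibly of length zero) whose set of initial vertices is `A`. -/
def Routable {V : Type*} (E : V → V → Prop) (B A : Finset V) : Prop :=
  ∃ f : V → List V,
    (∀ b ∈ B, (f b).Chain' E ∧ (f b).Nodup ∧ (f b).getLast? = some b) ∧
    (∀ b ∈ B, ∀ c ∈ B, b ≠ c → ∀ v, v ∈ f b → v ∉ f c) ∧
    (∀ a : V, a ∈ A ↔ ∃ b ∈ B, (f b).head? = some a)

/-- The edge relation of the graph obtained from `E` by `swap(i,j)`:
the edge `e_{ij}` is replaced by `e_{ji}`, every other edge `e_{ik}` out of `i`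
is replaced by `e_{jk}`, and all other edges are unchanged. -/
def swapGraph {V : Type*} (E : V → V → Prop) (i j : V) : V → V → Prop :=
  fun x y => (x ≠ i ∧ x ≠ j ∧ E x y) ∨ (x = j ∧ (y = i ∨ (E i y ∧ y ≠ j)))

/-- The planted graph `(E', B')` is obtained from `(E, B)` by a single swap
operation `swap(i,j)` for some `i ∉ B`, `j ∈ B` with `e_{ij} ∈ E`. -/
def SwapStep {V : Type*} [DecidableEq V]
    (p q : (V → V → Prop) × Finset V) : Prop :=
  ∃ i j : V, i ∉ p.2 ∧ j ∈ p.2 ∧ p.1 i j ∧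
    (∀ x y, q.1 x y ↔ swapGraph p.1 i j x y) ∧ q.2 = insert i (p.2.erase j)

/-- `Ebar` is (the edge relation of) the saturation of the planted graph `(E,B)`:
the unique maximal planted graph containing `(E,B)`, with the same sink set `B`
and the same routable sets. -/
def IsSaturation {V : Type*} [DecidableEq V] [Fintype V]
    (E : V → V → Prop) (B : Finset V) (Ebar : V → V → Prop) : Prop :=
  (∀ x y, E x y → Ebar x y) ∧
  IsPlanted Ebar B ∧
  (∀ A : Finset V, Routable Ebar B A ↔ Routable E B A) ∧
  (∀ E' : V → V → Prop, (∀ x y, Ebar x y → E' x y) → IsPlanted E' B →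
    (∀ A : Finset V, Routable E' B A ↔ Routable E B A) →
    ∀ x y, E' x y ↔ Ebar x y)

/-- `m` is a system of distinct representatives of the family `S`. -/
def IsSDR {V ι : Type*} (S : ι → Finset V) (m : ι → V) : Prop :=
  Function.Injective m ∧ ∀ i, m i ∈ S i

/-- `T` is a transversal of the family `S`. -/
def IsTransversal {V ι : Type*} (S : ι → Finset V) (T : Finset V) : Prop :=
  ∃ m, IsSDR S m ∧ ∀ y, y ∈ T ↔ ∃ i, m i = y

/-- No set of the family `S` can be enlarged without creating new transversals. -/
def IsMaximalFamily {V ι : Type*} [DecidableEq V] [DecidableEq ι] (S : ι → Finset V) : Prop :=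
  ∀ i x, x ∉ S i →
    ∃ T, IsTransversal (Function.update S i (insert x (S i))) T ∧ ¬ IsTransversal S T

/-- The indices of the sets of the family that meet `X`. -/
def meetingIndices {V ι : Type*} [DecidableEq V] [Fintype ι] (S : ι → Finset V)
    (X : Finset V) : Finset ι :=
  Finset.univ.filter fun i => ∃ x ∈ X, x ∈ S i

/-- `X` is cyclic with respect to a family of bases: no element of `X` is needed in order
to attain the largest possible intersection of `X` with a basis. -/
def IsCyclicFor {V : Type*} [DecidableEq V] (P : Finset V → Prop) (X : Finset V) : Prop :=
  ∀ x ∈ X, ∀ T, P T → ∃ T', P T' ∧ (T ∩ X).card ≤ (T' ∩ X.erase x).card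

theorem IsSDR.update {V ι : Type*} [DecidableEq ι] {S : ι → Finset V} {m : ι → V}
    (hm : IsSDR S m) {i : ι} {y : V}
    (hy : y ∈ S i) (hfree : ∀ k, m k ≠ y) : IsSDR S (Function.update m i y) := by
  refine ⟨fun a b hab => ?_, fun a => ?_⟩
  · by_cases ha : a = i <;> by_cases hb : b = i <;>
      simp only [Function.update_apply, ha, hb, if_true, if_false] at hab ⊢
    · exact (hfree b hab.symm).elim
    · exact (hfree a hab).elim
    · exact hm.1 hab
  · by_cases ha : a = i
    · subst ha; simpa
    · simpa [ha] using hm.2 a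

section Families

variable {V ι κ : Type*} [DecidableEq V] [Fintype ι]

theorem isTransversal_image {S : ι → Finset V} {m : ι → V} (hm : IsSDR S m) :
    IsTransversal S (Finset.univ.image m) :=
  ⟨m, hm, by simp⟩

theorem IsTransversal.card_eq {S : ι → Finset V} {T : Finset V} (hT : IsTransversal S T) :
    T.card = Fintype.card ι := by
  obtain ⟨m, hm, h⟩ := hT
  have : T = Finset.univ.image m := by ext y; simp [h]
  rw [this, Finset.card_image_of_injective _ hm.1, Finset.card_univ]

/-- Every partial transversal of a family that has a transversal extends to a transversal. -/
theorem exists_isTransversal_superset {S : ι → Finset V} {m : ι → V} (hm : IsSDR S m)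
    (J : Finset ι) (p : ι → V) (hp : ∀ i ∈ J, p i ∈ S i) :
    ∃ T, IsTransversal S T ∧ J.image p ⊆ T := by
  classical
  suffices H : ∀ n (h : ι → V), IsSDR S h → (J.filter fun i => h i ≠ p i).card = n →
      ∃ T, IsTransversal S T ∧ J.image p ⊆ T from H _ m hm rfl
  intro n
  induction n using Nat.strong_induction_on with
  | _ n ih =>
    intro h hh hn
    by_cases hc : ∃ j ∈ J, ∀ k, h k ≠ p j
    · obtain ⟨j, hj, hfree⟩ := hc
      refine ih _ ?_ (Function.update h j (p j)) (hh.update (hp j hj) hfree) rfl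
      rw [← hn]
      apply Finset.card_lt_card
      rw [Finset.ssubset_iff_of_subset]
      · exact ⟨j, by simp [hj, hfree j], by simp⟩
      · intro a
        by_cases ha : a = j <;> simp [ha]
    · push Not at hc
      refine ⟨_, isTransversal_image hh, ?_⟩
      intro y hy
      obtain ⟨j, hj, rfl⟩ := Finset.mem_image.1 hy
      obtain ⟨k, hk⟩ := hc j hj
      exact Finset.mem_image.2 ⟨k, Finset.mem_univ _, hk⟩

theorem IsSDR.card_image_inter {S : ι → Finset V} {m : ι → V} (hm : IsSDR S m)
    {T : Finset V} (hT : ∀ y, y ∈ T ↔ ∃ i, m i = y) (X : Finset V) :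
    (T ∩ X).card = (Finset.univ.filter fun i => m i ∈ X).card := by
  have : T ∩ X = (Finset.univ.filter fun i => m i ∈ X).image m := by
    ext y
    simp only [Finset.mem_inter, hT, Finset.mem_image, Finset.mem_filter, Finset.mem_univ,
      true_and]
    constructor
    · rintro ⟨⟨i, rfl⟩, h⟩; exact ⟨i, h, rfl⟩
    · rintro ⟨i, h, rfl⟩; exact ⟨⟨i, rfl⟩, h⟩
  rw [this, Finset.card_image_of_injective _ hm.1]

theorem IsTransversal.card_inter_le {S : ι → Finset V} {T : Finset V} (hT : IsTransversal S T)
    (X : Finset V) : (T ∩ X).card ≤ (meetingIndices S X).card := by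
  obtain ⟨m, hm, h⟩ := hT
  rw [hm.card_image_inter h]
  apply Finset.card_le_card
  intro i hi
  simp only [meetingIndices, Finset.mem_filter, Finset.mem_univ, true_and] at hi ⊢
  exact ⟨_, hi, hm.2 i⟩

/-- A cyclic set meets some transversal in as many elements as there are sets of the family
meeting it. -/
theorem exists_card_inter_eq_of_isCyclicFor {S : ι → Finset V} {m : ι → V} (hm : IsSDR S m)
    {X : Finset V} (hX : IsCyclicFor (IsTransversal S) X) :
    ∃ T, IsTransversal S T ∧ (meetingIndices S X).card ≤ (T ∩ X).card := by
  classical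
  by_contra! hcon
  obtain ⟨T, hT, hmax⟩ : ∃ T, IsTransversal S T ∧
      ∀ T', IsTransversal S T' → (T' ∩ X).card ≤ (T ∩ X).card := by
    have hb : ∀ k, (∃ T, IsTransversal S T ∧ (T ∩ X).card = k) → k ≤ X.card := by
      rintro k ⟨T, -, rfl⟩
      exact Finset.card_le_card Finset.inter_subset_right
    classical
    obtain ⟨T, hT, hk⟩ := Nat.findGreatest_spec
      (P := fun k => ∃ T, IsTransversal S T ∧ (T ∩ X).card = k)
      (hb _ ⟨_, isTransversal_image hm, rfl⟩) ⟨_, isTransversal_image hm, rfl⟩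
    refine ⟨T, hT, fun T' hT' => ?_⟩
    rw [hk]
    exact Nat.le_findGreatest (hb _ ⟨T', hT', rfl⟩) ⟨T', hT', rfl⟩
  set k := (T ∩ X).card with hk
  have hkN := hcon T hT
  set N := meetingIndices S X with hN
  set d := N.card - (k + 1) with hd
  let t : N → Finset (V ⊕ Fin d) := fun i => (S i ∩ X).disjSum Finset.univ
  by_cases hHall : ∀ K : Finset N, K.card ≤ (K.biUnion t).card
  · obtain ⟨f, hf, hft⟩ := (Finset.all_card_le_biUnion_card_iff_exists_injective t).1 hHall
    let J : Finset N := Finset.univ.filter fun i => (f i).isLeft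
    let p : ι → V := fun i => if h : i ∈ N then (f ⟨i, h⟩).elim id fun _ => m i else m i
    have hpJ : ∀ i ∈ J, f i = Sum.inl (p i) := by
      intro i hi
      have hi' : (f i).isLeft := by simpa [J] using hi
      obtain ⟨v, hv⟩ := Sum.isLeft_iff.1 hi'
      simp [p, hv]
    have hJcard : k + 1 ≤ J.card := by
      have h1 : J.card + (Finset.univ.filter fun i : N => ¬ (f i).isLeft).card = N.card := by
        rw [Finset.card_filter_add_card_filter_not]; simp
      have h2 : (Finset.univ.filter fun i : N => ¬ (f i).isLeft).card ≤ d := by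
        have : (Finset.univ.filter fun i : N => ¬ (f i).isLeft).image f ⊆
            (Finset.univ : Finset (Fin d)).image Sum.inr := by
          intro z hz
          obtain ⟨i, hi, rfl⟩ := Finset.mem_image.1 hz
          rcases hfi : f i with v | v
          · simp [hfi] at hi
          · simp
        have := Finset.card_le_card this
        rwa [Finset.card_image_of_injective _ hf,
          Finset.card_image_of_injective _ Sum.inr_injective, Finset.card_univ,
          Fintype.card_fin] at this
      omega
    have hpX : ∀ i ∈ J, p i ∈ S i ∧ p i ∈ X := by
      intro i hi
      have := hft i
      rw [hpJ i hi] at this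
      simpa [t] using this
    have hpinj : Set.InjOn p (J.map (Function.Embedding.subtype _)) := by
      intro a ha b hb hab
      simp only [Finset.coe_map, Set.mem_image, Finset.mem_coe] at ha hb
      obtain ⟨a, ha, rfl⟩ := ha
      obtain ⟨b, hb, rfl⟩ := hb
      have : f a = f b := by
        rw [hpJ a ha, hpJ b hb]; exact congrArg _ hab
      rw [hf this]
    obtain ⟨T', hT', hsub⟩ := exists_isTransversal_superset hm
      (J.map (Function.Embedding.subtype _)) p (by
        intro i hi
        obtain ⟨i, hi', rfl⟩ := Finset.mem_map.1 hi
        exact (hpX i hi').1)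
    have h3 : (J.map (Function.Embedding.subtype _)).image p ⊆ T' ∩ X := by
      refine Finset.subset_inter hsub ?_
      intro y hy
      obtain ⟨i, hi, rfl⟩ := Finset.mem_image.1 hy
      obtain ⟨i, hi', rfl⟩ := Finset.mem_map.1 hi
      exact (hpX i hi').2
    have h4 := Finset.card_le_card h3
    rw [Finset.card_image_of_injOn hpinj, Finset.card_map] at h4
    have := hmax T' hT'
    omega
  · push Not at hHall
    obtain ⟨K, hK⟩ := hHall
    let W : Finset V := K.biUnion fun i => S i ∩ X
    have hKne : K.Nonempty := by
      rw [Finset.nonempty_iff_ne_empty]; rintro rfl; simp at hK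
    have hcard : W.card + d < K.card := by
      refine lt_of_le_of_lt ?_ hK
      have : W.disjSum (Finset.univ : Finset (Fin d)) ⊆ K.biUnion t := by
        rintro (v | v) hv
        · simpa [W, t] using hv
        · obtain ⟨i, hi⟩ := hKne
          exact Finset.mem_biUnion.2 ⟨i, hi, by simp [t]⟩
      have := Finset.card_le_card this
      rwa [Finset.card_disjSum, Finset.card_univ, Fintype.card_fin] at this
    obtain ⟨i, hi⟩ := hKne
    obtain ⟨w, hwX, hwS⟩ : ∃ x ∈ X, x ∈ S i := by
      have := i.2
      simpa [hN, meetingIndices] using this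
    have hwW : w ∈ W := Finset.mem_biUnion.2 ⟨i, hi, by simp [hwS, hwX]⟩
    obtain ⟨T', hT', hle⟩ := hX w hwX T hT
    obtain ⟨h, hh, hhT⟩ := hT'
    rw [hh.card_image_inter hhT] at hle
    have hsub : (Finset.univ.filter fun i => h i ∈ X.erase w) ⊆
        (Finset.univ.filter fun i => h i ∈ W.erase w) ∪
          (N \ K.map (Function.Embedding.subtype _)) := by
      intro j hj
      simp only [Finset.mem_filter, Finset.mem_univ, true_and, Finset.mem_erase] at hj
      by_cases hjW : h j ∈ W
      · simp [hjW, hj.1]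
      · refine Finset.mem_union_right _ (Finset.mem_sdiff.2 ⟨?_, ?_⟩)
        · simp only [hN, meetingIndices, Finset.mem_filter, Finset.mem_univ, true_and]
          exact ⟨_, hj.2, hh.2 j⟩
        · intro hjK
          obtain ⟨j, hjK', rfl⟩ := Finset.mem_map.1 hjK
          exact hjW (Finset.mem_biUnion.2 ⟨j, hjK', Finset.mem_inter.2 ⟨hh.2 _, hj.2⟩⟩)
    have h1 := (Finset.card_le_card hsub).trans (Finset.card_union_le _ _)
    have h2 : (Finset.univ.filter fun i => h i ∈ W.erase w).card ≤ W.card - 1 := by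
      rw [← hh.card_image_inter hhT, ← Finset.card_erase_of_mem hwW]
      exact Finset.card_le_card Finset.inter_subset_right
    have h3 : (N \ K.map (Function.Embedding.subtype _)).card = N.card - K.card := by
      rw [Finset.card_sdiff_of_subset, Finset.card_map]
      intro j hj
      obtain ⟨j, -, rfl⟩ := Finset.mem_map.1 hj
      exact j.2
    have h4 : K.card ≤ N.card := by
      have := Finset.card_le_univ K
      simpa using this
    have h5 : 0 < W.card := Finset.card_pos.2 ⟨w, hwW⟩
    omega

/-- The complement of a set of a maximal family is cyclic. -/
theorem IsMaximalFamily.isCyclicFor_compl [Fintype V] [DecidableEq ι] {S : ι → Finset V}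
    (hS : IsMaximalFamily S) (i : ι) : IsCyclicFor (IsTransversal S) (S i)ᶜ := by
  intro x hx T₀ hT₀
  rw [Finset.mem_compl] at hx
  obtain ⟨T, ⟨m, hm, hmT⟩, hnT⟩ := hS i x hx
  obtain ⟨h, hh, hhT⟩ := hT₀
  have hmS : ∀ l, l ≠ i → m l ∈ S l := fun l hl => by simpa [hl] using hm.2 l
  have hmi : m i = x := by
    by_contra hne
    refine hnT ⟨m, ⟨hm.1, fun l => ?_⟩, hmT⟩
    by_cases hl : l = i
    · subst hl
      have := hm.2 l
      simpa [hne] using this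
    · exact hmS l hl
  let t : T → Finset ι := fun y => Finset.univ.filter fun l => (y : V) ∈ S l
  obtain ⟨Y, hY⟩ : ∃ Y : Finset T, (Y.biUnion t).card < Y.card := by
    by_contra! hcon
    obtain ⟨f, hf, hft⟩ := (Finset.all_card_le_biUnion_card_iff_exists_injective t).1 hcon
    have hcard : Fintype.card T = Fintype.card ι := by
      rw [Fintype.card_coe]; exact IsTransversal.card_eq ⟨m, hm, hmT⟩
    let e : T ≃ ι := Equiv.ofBijective f ((Fintype.bijective_iff_injective_and_card f).2
      ⟨hf, hcard⟩)
    refine hnT ⟨fun l => e.symm l, ⟨Subtype.val_injective.comp e.symm.injective, fun l => ?_⟩,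
      fun y => ⟨fun hy => ⟨e ⟨y, hy⟩, by simp⟩, ?_⟩⟩
    · have := hft (e.symm l)
      simp only [t, Finset.mem_filter, Finset.mem_univ, true_and] at this
      have h2 : f (e.symm l) = l := e.apply_symm_apply l
      rwa [h2] at this
    · rintro ⟨l, rfl⟩; exact (e.symm l).2
  let N := Y.biUnion t
  let P : Finset ι := Finset.univ.filter fun l => ∃ y ∈ Y, m l = (y : V)
  have hPY : P.card = Y.card := by
    have : P.image m = Y.map (Function.Embedding.subtype _) := by
      ext y
      simp only [P, Finset.mem_image, Finset.mem_filter, Finset.mem_univ, true_and,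
        Finset.mem_map, Function.Embedding.subtype_apply]
      constructor
      · rintro ⟨l, ⟨z, hz, hlz⟩, rfl⟩; exact ⟨z, hz, hlz.symm⟩
      · rintro ⟨z, hz, rfl⟩
        obtain ⟨l, hl⟩ := (hmT z).1 z.2
        exact ⟨l, ⟨z, hz, hl⟩, hl⟩
    rw [← Finset.card_image_of_injective P hm.1, this, Finset.card_map]
  have hPN : P.erase i ⊆ N := by
    intro l hl
    simp only [P, Finset.mem_erase, Finset.mem_filter, Finset.mem_univ, true_and] at hl
    obtain ⟨hli, y, hy, hly⟩ := hl
    refine Finset.mem_biUnion.2 ⟨y, hy, ?_⟩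
    simp only [t, Finset.mem_filter, Finset.mem_univ, true_and, ← hly]
    exact hmS l hli
  have hNY : N.card < Y.card := hY
  have hNeq : P.erase i = N := by
    refine Finset.eq_of_subset_of_card_le hPN ?_
    have := Finset.pred_card_le_card_erase (s := P) (a := i)
    omega
  have hmem : ∀ l, l ∈ N ↔ ∃ y ∈ Y, (y : V) ∈ S l := by simp [N, t]
  have hNm : ∀ l ∈ N, l ≠ i ∧ ∃ y ∈ Y, m l = (y : V) := by
    intro l hl
    rw [← hNeq] at hl
    simpa [P] using hl
  have hiN : i ∉ N := fun hi => (hNm i hi).1 rfl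
  have hxY : ∃ y ∈ Y, (y : V) = x := by
    by_contra hcon
    have : i ∉ P := by
      simp only [P, Finset.mem_filter, Finset.mem_univ, true_and, hmi]
      rintro ⟨y, hy, h⟩; exact hcon ⟨y, hy, h.symm⟩
    rw [Finset.erase_eq_of_notMem this] at hNeq
    rw [hNeq] at hPY
    omega
  let p : ι → V := fun l => if l ∈ N then m l else h l
  let J : Finset ι := N ∪ Finset.univ.filter fun l => h l ∈ (S i)ᶜ
  have hcross : ∀ a b, a ∈ N → b ∉ N → m a ≠ h b := by
    intro a b ha hb hab
    obtain ⟨-, y, hy, hay⟩ := hNm a ha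
    exact hb ((hmem b).2 ⟨y, hy, by rw [← hay, hab]; exact hh.2 b⟩)
  have hpinj : Set.InjOn p J := by
    intro a _ b _ hab
    by_cases ha : a ∈ N <;> by_cases hb : b ∈ N <;> simp only [p, ha, hb, if_true, if_false] at hab
    · exact hm.1 hab
    · exact (hcross a b ha hb hab).elim
    · exact (hcross b a hb ha hab.symm).elim
    · exact hh.1 hab
  obtain ⟨T', hT', hsub⟩ := exists_isTransversal_superset hh J p (by
    intro l _
    by_cases hl : l ∈ N
    · simp only [p, hl, if_true]; exact hmS l (hNm l hl).1
    · simp only [p, hl, if_false]; exact hh.2 l)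
  refine ⟨T', hT', ?_⟩
  rw [hh.card_image_inter hhT]
  calc _ ≤ J.card := Finset.card_le_card Finset.subset_union_right
    _ = (J.image p).card := (Finset.card_image_of_injOn hpinj).symm
    _ ≤ _ := by
      refine Finset.card_le_card (Finset.subset_inter hsub ?_)
      intro v hv
      obtain ⟨l, hl, rfl⟩ := Finset.mem_image.1 hv
      rw [Finset.mem_erase, Finset.mem_compl]
      by_cases hlN : l ∈ N
      · simp only [p, hlN, if_true]
        obtain ⟨hli, y, hy, hly⟩ := hNm l hlN
        refine ⟨fun h => hli (hm.1 (h.trans hmi.symm)), fun h => hiN ?_⟩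
        exact (hmem i).2 ⟨y, hy, by rwa [← hly]⟩
      · simp only [p, hlN, if_false]
        have h1 : h l ∈ (S i)ᶜ := by simpa [J, hlN] using hl
        refine ⟨fun hx' => hlN ?_, Finset.mem_compl.1 h1⟩
        obtain ⟨y, hy, hyx⟩ := hxY
        exact (hmem l).2 ⟨y, hy, by rw [hyx, ← hx']; exact hh.2 l⟩

variable [Fintype κ]

theorem card_meetingIndices_eq {S : ι → Finset V} {S' : κ → Finset V} {m : ι → V} {m' : κ → V}
    (hm : IsSDR S m) (hm' : IsSDR S' m') (h : ∀ T, IsTransversal S T ↔ IsTransversal S' T)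
    {X : Finset V} (hX : IsCyclicFor (IsTransversal S) X) :
    (meetingIndices S X).card = (meetingIndices S' X).card := by
  have hP : IsTransversal S = IsTransversal S' := funext fun T => propext (h T)
  obtain ⟨T, hT, hle⟩ := exists_card_inter_eq_of_isCyclicFor hm hX
  obtain ⟨T', hT', hle'⟩ := exists_card_inter_eq_of_isCyclicFor hm' (hP ▸ hX)
  exact le_antisymm (hle.trans (((h T).1 hT).card_inter_le X))
    (hle'.trans (((h T').2 hT').card_inter_le X))

theorem card_filter_subset_eq (S : ι → Finset V) (Z : Finset V) :
    (Finset.univ.filter fun i => S i ⊆ Z).card =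
      (∑ Y ∈ Z.ssubsets, (Finset.univ.filter fun i => S i = Y).card) +
        (Finset.univ.filter fun i => S i = Z).card := by
  have hpart : (Finset.univ.filter fun i => S i ⊆ Z).card =
      ∑ Y ∈ Z.powerset, (Finset.univ.filter fun i => S i = Y).card := by
    rw [Finset.card_eq_sum_card_fiberwise (f := S) (t := Z.powerset)]
    · refine Finset.sum_congr rfl fun Y hY => ?_
      congr 1
      ext i
      simp only [Finset.mem_filter, Finset.mem_univ, true_and, and_iff_right_iff_imp]
      rintro rfl
      exact Finset.mem_powerset.1 hY
    · intro i hi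
      simpa using hi
  rw [hpart, Finset.ssubsets, Finset.sum_erase_add _ _ (Finset.mem_powerset_self Z)]

/-- A maximal family is determined, up to reindexing, by its transversals. -/
theorem exists_equiv_of_isMaximalFamily [Fintype V] [DecidableEq ι] [DecidableEq κ]
    {S : ι → Finset V} {S' : κ → Finset V}
    {m : ι → V} {m' : κ → V} (hm : IsSDR S m) (hm' : IsSDR S' m')
    (h : ∀ T, IsTransversal S T ↔ IsTransversal S' T)
    (hS : IsMaximalFamily S) (hS' : IsMaximalFamily S') :
    ∃ e : ι ≃ κ, ∀ i, S' (e i) = S i := by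
  have hP : IsTransversal S = IsTransversal S' := funext fun T => propext (h T)
  have hcard : Fintype.card ι = Fintype.card κ := by
    rw [← (isTransversal_image hm).card_eq, ((h _).1 (isTransversal_image hm)).card_eq]
  have hsub : ∀ Z : Finset V, IsCyclicFor (IsTransversal S) Zᶜ →
      (Finset.univ.filter fun i => S i ⊆ Z).card =
        (Finset.univ.filter fun i => S' i ⊆ Z).card := by
    intro Z hZ
    have h0 := card_meetingIndices_eq hm hm' h hZ
    have h1 : (meetingIndices S Zᶜ) = (Finset.univ.filter fun i => ¬ S i ⊆ Z) := by
      ext i; simp [meetingIndices, Finset.subset_iff, and_comm]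
    have h2 : (meetingIndices S' Zᶜ) = (Finset.univ.filter fun i => ¬ S' i ⊆ Z) := by
      ext i; simp [meetingIndices, Finset.subset_iff, and_comm]
    have h3 := Finset.card_filter_add_card_filter_not (s := (Finset.univ : Finset ι))
      (fun i => S i ⊆ Z)
    have h4 := Finset.card_filter_add_card_filter_not (s := (Finset.univ : Finset κ))
      (fun i => S' i ⊆ Z)
    rw [Finset.card_univ] at h3 h4
    rw [h1, h2] at h0
    omega
  have hfib : ∀ Z : Finset V, (Finset.univ.filter fun i => S i = Z).card =
      (Finset.univ.filter fun i => S' i = Z).card := by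
    intro Z
    induction Z using Finset.strongInduction with
    | _ Z ih =>
      by_cases hZ : IsCyclicFor (IsTransversal S) Zᶜ
      · have h0 := hsub Z hZ
        rw [card_filter_subset_eq, card_filter_subset_eq,
          Finset.sum_congr rfl fun Y hY => ih Y (Finset.mem_ssubsets.1 hY)] at h0
        omega
      · rw [Finset.filter_false_of_mem, Finset.filter_false_of_mem]
        · simp
        · rintro i - rfl; exact hZ (hP ▸ hS'.isCyclicFor_compl i)
        · rintro i - rfl; exact hZ (hS.isCyclicFor_compl i)
  have heq : ∀ Z, Nonempty ({i // S i = Z} ≃ {i // S' i = Z}) := by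
    intro Z
    rw [← Fintype.card_eq, Fintype.card_subtype, Fintype.card_subtype]
    exact hfib Z
  exact ⟨Equiv.ofFiberEquiv fun Z => (heq Z).some, fun i => Equiv.ofFiberEquiv_map _ i⟩

end Families

/-- The planted graph determined by a family of sets and a system of distinct representatives:
the representative of each set is joined to the other elements of that set, and the sinks
are the vertices that represent no set. -/
noncomputable def plantedGraph {V ι : Type*} [Fintype V] (S : ι → Finset V) (m : ι → V) :
    (V → V → Prop) × Finset V :=
  open Classical in
  (fun x y => ∃ i, m i = x ∧ y ∈ S i ∧ y ≠ x, Finset.univ.filter fun x => ∀ i, m i ≠ x)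

/-- The closed out-neighborhoods of the vertices outside `B`. -/
noncomputable def outFamily {V : Type*} [Fintype V] (E : V → V → Prop) (B : Finset V) :
    {v // v ∉ B} → Finset V :=
  open Classical in fun v => Finset.univ.filter fun w => w = v ∨ E v w

section Routings

variable {V : Type*} {E : V → V → Prop} {B A : Finset V}

theorem List.Nodup.eq_of_getElem?_eq_some {α : Type*} {l : List α} (hl : l.Nodup) {a b : ℕ} {x : α}
    (ha : l[a]? = some x) (hb : l[b]? = some x) : a = b := by
  obtain ⟨ha', ha⟩ := List.getElem?_eq_some_iff.1 ha
  obtain ⟨hb', hb⟩ := List.getElem?_eq_some_iff.1 hb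
  exact hl.getElem_inj_iff.1 (ha.trans hb.symm)

/-- A routing gives rise to a matching of the non-sinks with the vertices that are not
initial, sending each vertex of a path to its successor and fixing all other vertices. -/
theorem Routable.exists_matching (h : Routable E B A) :
    ∃ g : {v // v ∉ B} → V, Function.Injective g ∧ (∀ v, g v = v ∨ E v (g v)) ∧
      ∀ w, w ∉ A ↔ ∃ v, g v = w := by
  classical
  obtain ⟨f, hf, hdisj, hA⟩ := h
  let R : V → V → Prop := fun v w => ∃ b ∈ B, ∃ k, (f b)[k]? = some v ∧ (f b)[k + 1]? = some w
  have huniq : ∀ {b c : V} {k l : ℕ} {v : V}, b ∈ B → c ∈ B →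
      (f b)[k]? = some v → (f c)[l]? = some v →
      b = c ∧ k = l := by
    intro b c k l v hb hc hk hl
    have hbc : b = c := by
      by_contra hne
      exact hdisj b hb c hc hne v (List.mem_of_getElem? hk) (List.mem_of_getElem? hl)
    subst hbc
    exact ⟨rfl, (hf b hb).2.1.eq_of_getElem?_eq_some hk hl⟩
  have hlast : ∀ {b}, b ∈ B → (f b)[(f b).length - 1]? = some b := fun hb => by
    rw [← List.getLast?_eq_getElem?]; exact (hf _ hb).2.2
  have hRE : ∀ {v w}, R v w → E v w := by
    rintro v w ⟨b, hb, k, hv, hw⟩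
    obtain ⟨hk, rfl⟩ := List.getElem?_eq_some_iff.1 hv
    obtain ⟨hk', rfl⟩ := List.getElem?_eq_some_iff.1 hw
    exact List.isChain_iff_getElem.1 (hf b hb).1 k hk'
  have hRinj : ∀ {v v' w}, R v w → R v' w → v = v' := by
    rintro v v' w ⟨b, hb, k, hv, hw⟩ ⟨c, hc, l, hv', hw'⟩
    obtain ⟨rfl, hkl⟩ := huniq hb hc hw hw'
    obtain rfl : k = l := by omega
    simpa [hv] using hv'
  have hRB : ∀ {v w}, R v w → v ∉ B := by
    rintro v w ⟨b, hb, k, hv, hw⟩ hvB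
    obtain ⟨rfl, hk⟩ := huniq hb hvB hv (hlast hvB)
    obtain ⟨hk', -⟩ := List.getElem?_eq_some_iff.1 hw
    omega
  have hRex : ∀ {b v}, b ∈ B → v ∈ f b → v ∉ B → ∃ w, R v w := by
    intro b v hb hv hvB
    obtain ⟨k, hk⟩ := List.mem_iff_getElem?.1 hv
    obtain ⟨hk', -⟩ := List.getElem?_eq_some_iff.1 hk
    have : k + 1 < (f b).length := by
      by_contra hcon
      obtain rfl : k = (f b).length - 1 := by omega
      rw [hlast hb] at hk
      exact hvB (Option.some_inj.1 hk ▸ hb)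
    exact ⟨_, b, hb, k, hk, List.getElem?_eq_getElem this⟩
  have hRmem : ∀ {v w}, R v w → ∃ b ∈ B, w ∈ f b := by
    rintro v w ⟨b, hb, k, -, hw⟩
    exact ⟨b, hb, List.mem_of_getElem? hw⟩
  have hRA : ∀ {v w}, R v w → w ∉ A := by
    rintro v w ⟨b, hb, k, -, hw⟩ hwA
    obtain ⟨c, hc, hwc⟩ := (hA w).1 hwA
    rw [List.head?_eq_getElem?] at hwc
    have := (huniq hb hc hw hwc).2
    omega
  let g : {v // v ∉ B} → V := fun v => if h : ∃ w, R v w then h.choose else v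
  have hg1 : ∀ v : {v // v ∉ B}, (∃ w, R v w) → R v (g v) := by
    intro v hv
    simp only [g, hv, dif_pos]
    exact hv.choose_spec
  have hg2 : ∀ v : {v // v ∉ B}, (¬ ∃ w, R v w) → g v = v := by
    intro v hv
    simp only [g, hv, dif_neg, not_false_iff]
  refine ⟨g, ?_, ?_, ?_⟩
  · intro v v' hvv
    apply Subtype.ext
    by_cases hv : ∃ w, R v w <;> by_cases hv' : ∃ w, R v' w
    · exact hRinj (hg1 v hv) (hvv ▸ hg1 v' hv')
    · have := hg1 v hv
      rw [hvv, hg2 v' hv'] at this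
      obtain ⟨b, hb, hm⟩ := hRmem this
      exact (hv' (hRex hb hm v'.2)).elim
    · have := hg1 v' hv'
      rw [← hvv, hg2 v hv] at this
      obtain ⟨b, hb, hm⟩ := hRmem this
      exact (hv (hRex hb hm v.2)).elim
    · rw [← hg2 v hv, hvv, hg2 v' hv']
  · intro v
    by_cases hv : ∃ w, R v w
    · exact Or.inr (hRE (hg1 v hv))
    · exact Or.inl (hg2 v hv)
  · intro w
    constructor
    · intro hw
      by_cases hwp : ∃ b ∈ B, w ∈ f b
      · obtain ⟨b, hb, hm⟩ := hwp
        obtain ⟨k, hk⟩ := List.mem_iff_getElem?.1 hm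
        obtain ⟨hk', hkw⟩ := List.getElem?_eq_some_iff.1 hk
        cases k with
        | zero => exact (hw ((hA w).2 ⟨b, hb, by rw [List.head?_eq_getElem?, hk]⟩)).elim
        | succ k =>
          have hR : R ((f b)[k]) w := ⟨b, hb, k, List.getElem?_eq_getElem _, hk⟩
          refine ⟨⟨_, hRB hR⟩, ?_⟩
          obtain ⟨c, hc, l, h1, h2⟩ := hg1 ⟨_, hRB hR⟩ ⟨_, hR⟩
          obtain ⟨rfl, rfl⟩ := huniq hb hc (List.getElem?_eq_getElem (by omega)) h1
          rw [hk] at h2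
          exact (Option.some_inj.1 h2).symm
      · have hwB : w ∉ B := fun hwB => hwp ⟨w, hwB, List.mem_of_getElem? (hlast hwB)⟩
        refine ⟨⟨w, hwB⟩, hg2 _ ?_⟩
        rintro ⟨z, b, hb, k, hk, -⟩
        exact hwp ⟨b, hb, List.mem_of_getElem? hk⟩
    · rintro ⟨v, rfl⟩
      by_cases hv : ∃ w, R v w
      · exact hRA (hg1 v hv)
      · rw [hg2 v hv]
        intro hvA
        obtain ⟨b, hb, hh⟩ := (hA _).1 hvA
        exact hv (hRex hb (List.mem_of_mem_head? hh) v.2)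

/-- A matching of the non-sinks with the complement of `A` along closed out-neighborhoods
gives rise to a routing of `A`. -/
theorem routable_of_matching [Fintype V] (g : {v // v ∉ B} → V) (hg : Function.Injective g)
    (hE : ∀ v, g v = v ∨ E v (g v)) (hA : ∀ w, w ∉ A ↔ ∃ v, g v = w) : Routable E B A := by
  classical
  let R : V → V → Prop := fun x y => ∃ h : x ∉ B, g ⟨x, h⟩ = y ∧ E x y
  have hex : ∀ b ∈ B, ∀ n : ℕ, ∃ l : List V, l.IsChain R ∧ l.Nodup ∧ l.getLast? = some b ∧
      ((∃ a ∈ A, l.head? = some a) ∨ l.length = n + 1) := by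
    intro b hb n
    induction n with
    | zero => exact ⟨[b], by simp⟩
    | succ n ih =>
      obtain ⟨l, hc, hn, hl, h | h⟩ := ih
      · exact ⟨l, hc, hn, hl, Or.inl h⟩
      · obtain ⟨x, t, rfl⟩ : ∃ x t, l = x :: t := List.exists_cons_of_length_eq_add_one h
        by_cases hx : x ∈ A
        · exact ⟨_, hc, hn, hl, Or.inl ⟨x, hx, rfl⟩⟩
        · obtain ⟨⟨w, hwB⟩, hw⟩ := (hA x).1 hx
          have hwl : w ∉ x :: t := by
            intro hwl
            obtain ⟨k, hk, hkw⟩ := List.mem_iff_getElem.1 hwl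
            have hlt : k + 1 < (x :: t).length := by
              by_contra hcon
              rw [List.getLast?_eq_getElem?] at hl
              obtain ⟨hl', hl⟩ := List.getElem?_eq_some_iff.1 hl
              have : (x :: t).length - 1 = k := by omega
              simp only [this] at hl
              exact hwB (hkw ▸ hl ▸ hb)
            obtain ⟨h1, h2, -⟩ := List.isChain_iff_getElem.1 hc k hlt
            have h3 : (x :: t)[k + 1] = (x :: t)[0] := by
              rw [← h2, List.getElem_cons_zero]
              exact (congrArg g (Subtype.ext hkw)).trans hw
            have := hn.getElem_inj_iff.1 h3
            omega
          refine ⟨w :: x :: t, ?_, List.nodup_cons.2 ⟨hwl, hn⟩, ?_, Or.inr (by simpa using h)⟩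
          · refine List.isChain_cons.2 ⟨?_, hc⟩
            intro y hy
            obtain rfl : x = y := by simpa using hy
            refine ⟨hwB, hw, ?_⟩
            rcases hE ⟨w, hwB⟩ with h1 | h1
            · exact (hwl (by rw [← hw, h1]; simp)).elim
            · rwa [hw] at h1
          · rw [List.getLast?_cons_cons]; exact hl
  have hex' : ∀ b : V, ∃ l : List V, b ∈ B → l.IsChain R ∧ l.Nodup ∧ l.getLast? = some b ∧
      ∃ a ∈ A, l.head? = some a := by
    intro b
    by_cases hb : b ∈ B
    · obtain ⟨l, hc, hn, hl, h | h⟩ := hex b hb (Fintype.card V)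
      · exact ⟨l, fun _ => ⟨hc, hn, hl, h⟩⟩
      · have := hn.length_le_card
        omega
    · exact ⟨[], fun h => (hb h).elim⟩
  choose f hf using hex'
  have hreach : ∀ {b v}, b ∈ B → v ∈ f b → Relation.ReflTransGen R v b := by
    intro b v hb hv
    obtain ⟨hc, -, hl, -⟩ := hf b hb
    generalize f b = l at hc hl hv
    induction l generalizing v with
    | nil => simp at hv
    | cons x t ih =>
      cases t with
      | nil =>
        obtain rfl : x = b := by simpa using hl
        obtain rfl : v = x := by simpa using hv
        exact .refl
      | cons y t =>
        obtain ⟨h1, h2⟩ := List.isChain_cons.1 hc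
        rw [List.getLast?_cons_cons] at hl
        rcases List.mem_cons.1 hv with rfl | hv
        · exact .head (h1 y (by simp)) (ih h2 hl (by simp))
        · exact ih h2 hl hv
  have hterm : ∀ {b c v}, b ∈ B → c ∈ B → Relation.ReflTransGen R v b →
      Relation.ReflTransGen R v c → b = c := by
    intro b c v hb hc h1 h2
    induction h1 using Relation.ReflTransGen.head_induction_on with
    | refl =>
      rcases h2.cases_head with h | ⟨y, ⟨h, -⟩, -⟩
      · exact h
      · exact (h hb).elim
    | head h _ ih =>
      rcases h2.cases_head with rfl | ⟨y, ⟨h3, h4, -⟩, h5⟩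
      · exact (h.1 hc).elim
      · obtain ⟨h6, h7, -⟩ := h
        rw [h7] at h4
        subst h4
        exact ih h5
  have hdisj : ∀ b ∈ B, ∀ c ∈ B, b ≠ c → ∀ v, v ∈ f b → v ∉ f c := fun b hb c hc hne v h1 h2 =>
    hne (hterm hb hc (hreach hb h1) (hreach hc h2))
  refine ⟨f, fun b hb => ⟨?_, (hf b hb).2.1, (hf b hb).2.2.1⟩, hdisj, ?_⟩
  · exact (hf b hb).1.imp fun x y h => h.2.2
  · let φ : V → V := fun b => (f b).head?.getD b
    have hφ : ∀ {b}, b ∈ B → (f b).head? = some (φ b) := by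
      intro b hb
      obtain ⟨-, -, -, a, -, ha⟩ := hf b hb
      simp [φ, ha]
    have hφinj : Set.InjOn φ B := by
      intro b hb c hc hbc
      by_contra hne
      exact hdisj b hb c hc hne _ (List.mem_of_mem_head? (hφ hb))
        (hbc ▸ List.mem_of_mem_head? (hφ hc))
    have hsub : B.image φ ⊆ A := by
      intro a ha
      obtain ⟨b, hb, rfl⟩ := Finset.mem_image.1 ha
      obtain ⟨-, -, -, a, haA, ha⟩ := hf b hb
      rw [hφ hb] at ha
      exact Option.some_inj.1 ha ▸ haA
    have hcard : A.card = B.card := by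
      have h1 : Aᶜ = Finset.univ.image g := by ext w; simp [hA w]
      have h2 : Aᶜ.card = Bᶜ.card := by
        rw [h1, Finset.card_image_of_injective _ hg, Finset.card_univ, Fintype.card_subtype]
        congr 1
        ext v
        simp
      have h3 := Finset.card_add_card_compl A
      have h4 := Finset.card_add_card_compl B
      omega
    have heq : B.image φ = A := Finset.eq_of_subset_of_card_le hsub (by
      rw [Finset.card_image_of_injOn hφinj, hcard])
    intro a
    rw [← heq, Finset.mem_image]
    refine exists_congr fun b => and_congr_right fun hb => ?_
    rw [hφ hb, Option.some_inj]

end Routings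

section PlantedGraphs

variable {V ι : Type*} [Fintype V]

/-- The linking theorem of Ingleton and Piff. -/
theorem routable_plantedGraph_iff [DecidableEq V] {S : ι → Finset V} {m : ι → V} (hm : IsSDR S m)
    (A : Finset V) :
    Routable (plantedGraph S m).1 (plantedGraph S m).2 A ↔ IsTransversal S Aᶜ := by
  have hB : ∀ v, v ∉ (plantedGraph S m).2 ↔ ∃ i, m i = v := by simp [plantedGraph]
  have hE : ∀ i y, (y = m i ∨ (plantedGraph S m).1 (m i) y) ↔ y ∈ S i := by
    intro i y
    constructor
    · rintro (rfl | ⟨k, hk, hy, -⟩)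
      · exact hm.2 i
      · exact hm.1 hk ▸ hy
    · intro hy
      by_cases h : y = m i
      · exact Or.inl h
      · exact Or.inr ⟨i, rfl, hy, h⟩
  constructor
  · intro h
    obtain ⟨g, hg, hgE, hgA⟩ := h.exists_matching
    refine ⟨fun i => g ⟨m i, (hB _).2 ⟨i, rfl⟩⟩, ⟨fun i k hik => ?_, fun i => ?_⟩, fun y => ?_⟩
    · exact hm.1 (Subtype.ext_iff.1 (hg hik))
    · exact (hE i _).1 (hgE _)
    · rw [Finset.mem_compl, hgA]
      constructor
      · rintro ⟨⟨v, hv⟩, rfl⟩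
        obtain ⟨i, rfl⟩ := (hB v).1 hv
        exact ⟨i, rfl⟩
      · rintro ⟨i, rfl⟩; exact ⟨_, rfl⟩
  · rintro ⟨h, hh, hhA⟩
    choose e he using fun v : {v // v ∉ (plantedGraph S m).2} => (hB v).1 v.2
    refine routable_of_matching (fun v => h (e v)) (fun v w hvw => ?_) (fun v => ?_) fun w => ?_
    · apply Subtype.ext
      rw [← he v, ← he w, hh.1 hvw]
    · have := (hE (e v) (h (e v))).2 (hh.2 _)
      rwa [he v] at this
    · rw [← Finset.mem_compl, hhA]
      constructor
      · rintro ⟨i, rfl⟩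
        refine ⟨⟨m i, (hB _).2 ⟨i, rfl⟩⟩, ?_⟩
        rw [hm.1 (he ⟨m i, (hB _).2 ⟨i, rfl⟩⟩)]
      · rintro ⟨v, rfl⟩; exact ⟨_, rfl⟩

theorem isSDR_outFamily (E : V → V → Prop) (B : Finset V) :
    IsSDR (outFamily E B) Subtype.val :=
  ⟨Subtype.val_injective, fun v => by simp [outFamily]⟩

theorem plantedGraph_outFamily {E : V → V → Prop} {B : Finset V} (h : IsPlanted E B) :
    plantedGraph (outFamily E B) Subtype.val = (E, B) := by
  refine Prod.ext (funext fun x => funext fun y => propext ?_) (Finset.ext fun x => ?_)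
  · simp only [plantedGraph, outFamily, Finset.mem_filter, Finset.mem_univ, true_and]
    constructor
    · rintro ⟨i, rfl, h1 | h1, h2⟩
      · exact (h2 h1).elim
      · exact h1
    · intro hxy
      exact ⟨⟨x, fun hx => h.2 x hx y hxy⟩, rfl, Or.inr hxy, by rintro rfl; exact h.1 _ hxy⟩
  · simp only [plantedGraph, Finset.mem_filter, Finset.mem_univ, true_and]
    exact ⟨fun hx => by_contra fun hxB => hx ⟨x, hxB⟩ rfl, fun hx i hi => i.2 (hi ▸ hx)⟩

theorem routable_iff_isTransversal_outFamily [DecidableEq V] {E : V → V → Prop} {B : Finset V}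
    (h : IsPlanted E B) (A : Finset V) :
    Routable E B A ↔ IsTransversal (outFamily E B) Aᶜ := by
  have := routable_plantedGraph_iff (isSDR_outFamily E B) A
  rwa [plantedGraph_outFamily h] at this

theorem IsSaturation.isMaximalFamily [DecidableEq V] {E Ebar : V → V → Prop} {B : Finset V}
    (h : IsSaturation E B Ebar) : IsMaximalFamily (outFamily Ebar B) := by
  obtain ⟨-, hpl, hR, hmax⟩ := h
  intro i x hx
  by_contra! hcon
  let E' : V → V → Prop := fun a b => Ebar a b ∨ (a = i ∧ b = x)
  have hxi : x ≠ i ∧ ¬ Ebar i x := by simpa [outFamily] using hx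
  have hpl' : IsPlanted E' B := by
    refine ⟨?_, ?_⟩
    · rintro v (hv | ⟨rfl, rfl⟩)
      · exact hpl.1 v hv
      · exact hxi.1 rfl
    · rintro b hb v (hv | ⟨rfl, rfl⟩)
      · exact hpl.2 b hb v hv
      · exact i.2 hb
  have hfam : outFamily E' B =
      Function.update (outFamily Ebar B) i (insert x (outFamily Ebar B i)) := by
    funext v
    by_cases hv : v = i
    · subst hv
      ext w
      simp only [outFamily, E', Function.update_self, Finset.mem_insert, Finset.mem_filter,
        Finset.mem_univ, true_and]
      tauto
    · have hv' : (v : V) ≠ i := fun h => hv (Subtype.ext h)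
      ext w
      simp only [outFamily, E', Function.update_of_ne hv, hv', false_and, or_false,
        Finset.mem_filter]
  have hE' := hmax E' (fun _ _ => Or.inl) hpl' (fun A => by
    rw [← hR A, routable_iff_isTransversal_outFamily hpl,
      routable_iff_isTransversal_outFamily hpl', hfam]
    refine ⟨hcon _, ?_⟩
    rintro ⟨m, hm, hmA⟩
    refine ⟨m, ⟨hm.1, fun v => ?_⟩, hmA⟩
    by_cases hv : v = i
    · subst hv; simpa using Or.inr (hm.2 v)
    · simpa [hv] using hm.2 v)
  exact hxi.2 ((hE' i x).1 (Or.inr ⟨rfl, rfl⟩))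

/-- Moving the representative of one set to an unused element of that set is a swap. -/
theorem plantedGraph_update [DecidableEq V] [DecidableEq ι] {S : ι → Finset V} {m : ι → V}
    (hm : IsSDR S m)
    {i : ι} {y : V} (hfree : ∀ k, m k ≠ y) :
    ((∀ a b, (plantedGraph S (Function.update m i y)).1 a b ↔
      swapGraph (plantedGraph S m).1 (m i) y a b) ∧
    (plantedGraph S (Function.update m i y)).2 =
      insert (m i) ((plantedGraph S m).2.erase y)) := by
  have hupd : ∀ k a, Function.update m i y k = a ↔ (k = i ∧ y = a) ∨ (k ≠ i ∧ m k = a) := by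
    intro k a
    by_cases hk : k = i <;> simp [hk]
  constructor
  · intro a b
    simp only [plantedGraph, swapGraph, hupd]
    constructor
    · rintro ⟨k, ⟨rfl, rfl⟩ | ⟨hk, rfl⟩, hb, hne⟩
      · refine Or.inr ⟨rfl, ?_⟩
        by_cases h : b = m k
        · exact Or.inl h
        · exact Or.inr ⟨⟨k, rfl, hb, h⟩, hne⟩
      · exact Or.inl ⟨fun h => hk (hm.1 h), hfree k, k, rfl, hb, hne⟩
    · rintro (⟨h1, h2, k, rfl, hb, hne⟩ | ⟨rfl, rfl | ⟨⟨k, hk, hb, -⟩, hne⟩⟩)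
      · exact ⟨k, Or.inr ⟨fun h => h1 (h ▸ rfl), rfl⟩, hb, hne⟩
      · exact ⟨i, Or.inl ⟨rfl, rfl⟩, hm.2 i, hfree i⟩
      · exact ⟨i, Or.inl ⟨rfl, rfl⟩, hm.1 hk ▸ hb, hne⟩
  · ext x
    simp only [plantedGraph, Finset.mem_filter, Finset.mem_univ, true_and, Finset.mem_insert,
      Finset.mem_erase, ne_eq, hupd]
    constructor
    · intro h
      by_cases hx : x = m i
      · exact Or.inl hx
      · refine Or.inr ⟨fun hxy => h i (Or.inl ⟨rfl, hxy.symm⟩), fun k hk => ?_⟩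
        by_cases hki : k = i
        · exact hx (hki ▸ hk.symm)
        · exact h k (Or.inr ⟨hki, hk⟩)
    · rintro (rfl | ⟨h1, h2⟩) k (⟨rfl, h3⟩ | ⟨hk, h3⟩)
      · exact hfree k h3.symm
      · exact hk (hm.1 h3)
      · exact h1 h3.symm
      · exact h2 k h3

theorem swapStep_update [DecidableEq V] [DecidableEq ι] {S : ι → Finset V} {m : ι → V}
    (hm : IsSDR S m)
    {i : ι} {y : V} (hy : y ∈ S i) (hfree : ∀ k, m k ≠ y) :
    SwapStep (plantedGraph S m) (plantedGraph S (Function.update m i y)) :=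
  ⟨m i, y, by simp [plantedGraph], by simpa [plantedGraph] using hfree,
    ⟨i, rfl, hy, (hfree i).symm⟩, plantedGraph_update hm hfree⟩

/-- Every swap of a planted graph moves the representative of one set of the family. -/
theorem SwapStep.exists_isSDR [DecidableEq V] {S : ι → Finset V} {m : ι → V} (hm : IsSDR S m)
    {q : (V → V → Prop) × Finset V} (h : SwapStep (plantedGraph S m) q) :
    ∃ m', IsSDR S m' ∧ q = plantedGraph S m' := by
  classical
  obtain ⟨a, y, -, hy, ⟨i, rfl, hyS, -⟩, hE, hB⟩ := h
  have hfree : ∀ k, m k ≠ y := by simpa [plantedGraph] using hy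
  obtain ⟨h1, h2⟩ := plantedGraph_update hm (i := i) hfree
  refine ⟨_, hm.update hyS hfree, Prod.ext (funext fun a => funext fun b => propext ?_) ?_⟩
  · rw [hE, h1]
  · rw [hB, h2]

end PlantedGraphs

section Connectivity

theorem exists_path_of_reflTransGen {α : Type*} {R : α → α → Prop} {a b : α}
    (h : Relation.ReflTransGen R a b) :
    ∃ (n : ℕ) (p : ℕ → α), p 0 = a ∧ p n = b ∧ ∀ j < n, R (p j) (p (j + 1)) := by
  induction h using Relation.ReflTransGen.head_induction_on with
  | refl => exact ⟨0, fun _ => b, rfl, rfl, by simp⟩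
  | @head a c h _ ih =>
    obtain ⟨n, p, h0, hn, hp⟩ := ih
    refine ⟨n + 1, fun j => Nat.casesOn j a p, rfl, hn, fun j hj => ?_⟩
    cases j with
    | zero => simpa [h0] using h
    | succ j => exact hp j (by omega)

/-- A shortest path from `P` to `Q` is injective and leaves `P` immediately. -/
theorem exists_shortest_path {α : Type*} {R : α → α → Prop} {P Q : α → Prop} {a b : α}
    (ha : P a) (hb : Q b) (h : Relation.ReflTransGen R a b) :
    ∃ (n : ℕ) (p : ℕ → α), P (p 0) ∧ Q (p n) ∧ (∀ j < n, R (p j) (p (j + 1))) ∧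
      (∀ i ≤ n, ∀ j ≤ n, p i = p j → i = j) ∧ ∀ j, 1 ≤ j → j ≤ n → ¬ P (p j) := by
  classical
  have hex : ∃ n, ∃ p : ℕ → α, P (p 0) ∧ Q (p n) ∧ ∀ j < n, R (p j) (p (j + 1)) := by
    obtain ⟨n, p, rfl, rfl, hp⟩ := exists_path_of_reflTransGen h
    exact ⟨n, p, ha, hb, hp⟩
  obtain ⟨p, h0, hn, hp⟩ := Nat.find_spec hex
  have hmin := fun k => Nat.find_min' hex (m := k)
  set n := Nat.find hex
  have hlt : ∀ i j, i < j → j ≤ n → p i ≠ p j := by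
    intro i j hij hj heq
    have := hmin (n - (j - i)) ⟨fun k => if k ≤ i then p k else p (k + (j - i)), by simpa, ?_,
      fun k hk => ?_⟩
    · omega
    · by_cases hc : n - (j - i) ≤ i
      · have h1 : n = j := by omega
        have h2 : n - (j - i) = i := by omega
        simp only [h2, le_refl, if_true, heq]
        rwa [← h1]
      · simp only [hc, if_false]
        rwa [Nat.sub_add_cancel (by omega)]
    · rcases lt_trichotomy k i with hki | rfl | hki
      · simp only [hki.le, Nat.succ_le_of_lt hki, if_true]
        exact hp k (by omega)
      · simp only [le_refl, if_true, Nat.not_succ_le_self, if_false, heq]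
        rw [show k + 1 + (j - k) = j + 1 by omega]
        exact hp j (by omega)
      · simp only [hki.not_ge, if_false, show ¬ k + 1 ≤ i by omega]
        rw [show k + 1 + (j - i) = k + (j - i) + 1 by omega]
        exact hp _ (by omega)
  refine ⟨n, p, h0, hn, hp, fun i hi j hj hij => ?_, fun j hj hjn hPj => ?_⟩
  · rcases lt_trichotomy i j with h | h | h
    · exact (hlt i j h hj hij).elim
    · exact h
    · exact (hlt j i h hi hij.symm).elim
  · have := hmin (n - j) ⟨fun k => p (k + j), by simpa, by simpa [Nat.sub_add_cancel hjn],
      fun k hk => by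
        beta_reduce
        rw [show k + 1 + j = k + j + 1 by omega]
        exact hp _ (by omega)⟩
    omega

variable {V ι : Type*} [DecidableEq V] [DecidableEq ι]
  {S : ι → Finset V}

/-- Undoing the move of a representative is again a swap. -/
theorem swapStep_of_update [Fintype V] {m : ι → V} (hm : IsSDR S m) {i : ι} {y : V} (hy : y ∈ S i)
    (hfree : ∀ k, m k ≠ y) :
    SwapStep (plantedGraph S (Function.update m i y)) (plantedGraph S m) := by
  have hfree' : ∀ k, Function.update m i y k ≠ m i := by
    intro k
    by_cases hk : k = i
    · subst hk; simpa using (hfree k).symm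
    · simpa [hk] using fun h => hk (hm.1 h)
  simpa using swapStep_update (hm.update hy hfree) (hm.2 i) hfree'

/-- If two systems of distinct representatives with the same range disagree at the start of
a path that leads to a free vertex and along which they otherwise agree, then sliding both
along the path makes them agree in one more place. -/
theorem exists_slide [Fintype V] [Fintype ι] (k : ℕ) : ∀ (p : ℕ → ι) (b : V) (m m' : ι → V),
    IsSDR S m → IsSDR S m' →
    (∀ y, (∃ i, m i = y) ↔ ∃ i, m' i = y) → (∀ j < k, m (p (j + 1)) ∈ S (p j)) →
    (∀ i ≤ k, ∀ j ≤ k, p i = p j → i = j) → (∀ j, 1 ≤ j → j ≤ k → m (p j) = m' (p j)) →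
    b ∈ S (p k) → (∀ i, m i ≠ b) → m (p 0) ≠ m' (p 0) →
    ∃ m₁ m₁', IsSDR S m₁ ∧ IsSDR S m₁' ∧
      Relation.ReflTransGen SwapStep (plantedGraph S m) (plantedGraph S m₁) ∧
      Relation.ReflTransGen SwapStep (plantedGraph S m₁') (plantedGraph S m') ∧
      (Finset.univ.filter fun i => m₁ i ≠ m₁' i).card <
        (Finset.univ.filter fun i => m i ≠ m' i).card := by
  induction k with
  | zero =>
    intro p b m m' hm hm' hrange _ _ _ hb hfree hne
    have hfree' : ∀ i, m' i ≠ b := fun i hi => by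
      obtain ⟨j, hj⟩ := (hrange b).2 ⟨i, hi⟩
      exact hfree j hj
    refine ⟨_, _, hm.update hb hfree, hm'.update hb hfree', .single (swapStep_update hm hb hfree),
      .single (swapStep_of_update hm' hb hfree'), Finset.card_lt_card ?_⟩
    rw [Finset.ssubset_iff_of_subset]
    · exact ⟨p 0, by simpa using hne, by simp⟩
    · intro a
      by_cases ha : a = p 0 <;> simp [ha]
  | succ k ih =>
    intro p b m m' hm hm' hrange hadj hinj hagree hb hfree hne
    have hfree' : ∀ i, m' i ≠ b := fun i hi => by
      obtain ⟨j, hj⟩ := (hrange b).2 ⟨i, hi⟩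
      exact hfree j hj
    have hlast := hagree (k + 1) (by omega) le_rfl
    have hpne : ∀ j ≤ k, p j ≠ p (k + 1) := fun j hj h => by
      have := hinj j (by omega) (k + 1) le_rfl h
      omega
    have hrange' : ∀ y, (∃ i, Function.update m (p (k + 1)) b i = y) ↔
        ∃ i, Function.update m' (p (k + 1)) b i = y := by
      have key : ∀ n n' : ι → V, IsSDR S n → n (p (k + 1)) = n' (p (k + 1)) →
          (∀ y, (∃ i, n i = y) → ∃ i, n' i = y) →
          ∀ y, (∃ i, Function.update n (p (k + 1)) b i = y) →
            ∃ i, Function.update n' (p (k + 1)) b i = y := by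
        rintro n n' hn h1 h2 y ⟨i, rfl⟩
        by_cases hi : i = p (k + 1)
        · exact ⟨p (k + 1), by simp [hi]⟩
        · obtain ⟨j, hj⟩ := h2 (n i) ⟨i, rfl⟩
          refine ⟨j, ?_⟩
          have hjp : j ≠ p (k + 1) := by
            rintro rfl
            exact hi (hn.1 (hj.symm.trans h1.symm))
          simp [hi, hjp, hj]
      exact fun y => ⟨key m m' hm hlast (fun y => (hrange y).1) y,
        key m' m hm' hlast.symm (fun y => (hrange y).2) y⟩
    obtain ⟨m₁, m₁', h1, h2, h3, h4, h5⟩ := ih p (m (p (k + 1))) _ _ (hm.update hb hfree)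
      (hm'.update hb hfree') hrange'
      (fun j hj => by
        rw [Function.update_of_ne (hpne (j + 1) hj)]
        exact hadj j (by omega))
      (fun i hi j hj => hinj i (by omega) j (by omega))
      (fun j hj hjk => by
        rw [Function.update_of_ne (hpne j hjk), Function.update_of_ne (hpne j hjk)]
        exact hagree j hj (by omega))
      (hadj k (by omega))
      (fun i => by
        by_cases hi : i = p (k + 1)
        · subst hi; simpa using (hfree _).symm
        · simpa [hi] using fun h => hi (hm.1 h))
      (by rwa [Function.update_of_ne (hpne 0 (by omega)),
        Function.update_of_ne (hpne 0 (by omega))])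
    refine ⟨m₁, m₁', h1, h2, .head (swapStep_update hm hb hfree) h3,
      h4.tail (swapStep_of_update hm' hb hfree'), h5.trans_le (Finset.card_le_card ?_)⟩
    intro a
    by_cases ha : a = p (k + 1) <;> simp [ha]

/-- In a maximal family all sets whose representatives are reachable from a vertex that cannot
reach a free vertex are equal. -/
theorem IsMaximalFamily.eq_of_not_reach [Fintype ι] (hS : IsMaximalFamily S)
    {m : ι → V} (hm : IsSDR S m)
    {i : ι} (hi : ∀ j, Relation.ReflTransGen (fun a b => m b ∈ S a) i j →
      ∀ y ∈ S j, ∃ k, m k = y) {l : ι} (hl : m l ∈ S i) : S i = S l := by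
  classical
  let J : Finset ι := Finset.univ.filter (Relation.ReflTransGen (fun a b => m b ∈ S a) i)
  have hJ : ∀ j, j ∈ J ↔ Relation.ReflTransGen (fun a b => m b ∈ S a) i j := by simp [J]
  have hsub : ∀ j ∈ J, S j ⊆ J.image m := by
    intro j hj y hy
    obtain ⟨k, rfl⟩ := hi j ((hJ j).1 hj) y hy
    exact Finset.mem_image_of_mem _ ((hJ k).2 (((hJ j).1 hj).tail hy))
  have heq : ∀ j ∈ J, S j = J.image m := by
    intro j hj
    refine (hsub j hj).antisymm fun x hx => ?_
    by_contra hxj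
    obtain ⟨T, ⟨g, hg, hgT⟩, hT⟩ := hS j x hxj
    have hgJ : ∀ a ∈ J, g a ∈ J.image m := by
      intro a ha
      have := hg.2 a
      by_cases haj : a = j
      · subst haj
        rw [Function.update_self, Finset.mem_insert] at this
        rcases this with h | h
        · rwa [h]
        · exact hsub a ha h
      · rw [Function.update_of_ne haj] at this
        exact hsub a ha this
    have himg : J.image g = J.image m := by
      refine Finset.eq_of_subset_of_card_le (Finset.image_subset_iff.2 hgJ) ?_
      rw [Finset.card_image_of_injective _ hg.1, Finset.card_image_of_injective _ hm.1]
    have hcross : ∀ a b, a ∈ J → b ∉ J → m a ≠ g b := by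
      intro a b ha hb hab
      have : m a ∈ J.image g := himg ▸ Finset.mem_image_of_mem m ha
      rw [hab] at this
      obtain ⟨c, hc, hcb⟩ := Finset.mem_image.1 this
      exact hb (hg.1 hcb ▸ hc)
    refine hT ⟨fun a => if a ∈ J then m a else g a, ⟨?_, fun a => ?_⟩, fun y => ?_⟩
    · intro a b hab
      by_cases ha : a ∈ J <;> by_cases hb : b ∈ J <;> simp only [ha, hb, if_true, if_false] at hab
      · exact hm.1 hab
      · exact (hcross a b ha hb hab).elim
      · exact (hcross b a hb ha hab.symm).elim
      · exact hg.1 hab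
    · by_cases ha : a ∈ J
      · simpa [ha] using hm.2 a
      · have haj : a ≠ j := fun h => ha (h ▸ hj)
        simpa [ha, haj] using hg.2 a
    · rw [hgT]
      constructor
      · rintro ⟨a, rfl⟩
        by_cases ha : a ∈ J
        · obtain ⟨c, hc, hca⟩ := Finset.mem_image.1 (hgJ a ha)
          exact ⟨c, by simp [hc, hca]⟩
        · exact ⟨a, by simp [ha]⟩
      · rintro ⟨a, rfl⟩
        by_cases ha : a ∈ J
        · have : m a ∈ J.image g := himg ▸ Finset.mem_image_of_mem m ha
          obtain ⟨c, -, hc⟩ := Finset.mem_image.1 this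
          exact ⟨c, by simp [ha, hc]⟩
        · exact ⟨a, by simp [ha]⟩
  rw [heq i ((hJ i).2 .refl), heq l ((hJ l).2 (.single hl))]

/-- Any two systems of distinct representatives of a maximal family determine planted graphs
that are connected by swaps. -/
theorem IsMaximalFamily.reflTransGen_swapStep [Fintype V] [Fintype ι] (hS : IsMaximalFamily S)
    {m m' : ι → V}
    (hm : IsSDR S m) (hm' : IsSDR S m') :
    Relation.ReflTransGen SwapStep (plantedGraph S m) (plantedGraph S m') := by
  generalize hn : (Finset.univ.filter fun i => m i ≠ m' i).card = n
  induction n using Nat.strong_induction_on generalizing m m' with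
  | _ n ih =>
    subst hn
    by_cases hfree : ∃ i, ∀ k, m k ≠ m' i
    · obtain ⟨i, hi⟩ := hfree
      refine .head (swapStep_update hm (hm'.2 i) hi)
        (ih _ (Finset.card_lt_card ?_) (hm.update (hm'.2 i) hi) hm' rfl)
      rw [Finset.ssubset_iff_of_subset]
      · exact ⟨i, by simpa using hi i, by simp⟩
      · intro a
        by_cases ha : a = i <;> simp [ha]
    push Not at hfree
    have hrange : ∀ y, (∃ i, m i = y) ↔ ∃ i, m' i = y := by
      have h1 : Finset.univ.image m' ⊆ Finset.univ.image m := by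
        intro y hy
        obtain ⟨i, -, rfl⟩ := Finset.mem_image.1 hy
        obtain ⟨k, hk⟩ := hfree i
        exact Finset.mem_image.2 ⟨k, Finset.mem_univ _, hk⟩
      have h2 := Finset.eq_of_subset_of_card_le h1 (by
        rw [Finset.card_image_of_injective _ hm.1, Finset.card_image_of_injective _ hm'.1])
      intro y
      have := Finset.ext_iff.1 h2 y
      simpa using this.symm
    by_cases hreach : ∃ i j, m i ≠ m' i ∧
        Relation.ReflTransGen (fun a b => m b ∈ S a) i j ∧ ∃ y ∈ S j, ∀ k, m k ≠ y
    · obtain ⟨i, j, hi, hij, hj⟩ := hreach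
      obtain ⟨k, p, h0, ⟨b, hb, hbfree⟩, hp, hinj, havoid⟩ := exists_shortest_path
        (P := fun i => m i ≠ m' i) (Q := fun j => ∃ y ∈ S j, ∀ k, m k ≠ y) hi hj hij
      obtain ⟨m₁, m₁', h1, h2, h3, h4, h5⟩ := exists_slide k p b m m' hm hm' hrange hp hinj
        (fun j h1 h2 => not_not.1 (havoid j h1 h2)) hb hbfree h0
      exact h3.trans ((ih _ h5 h1 h2 rfl).trans h4)
    · push Not at hreach
      by_cases heq : m = m'
      · rw [heq]
      · obtain ⟨i, hi⟩ := Function.ne_iff.1 heq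
        obtain ⟨l, hl⟩ := hfree i
        have hli : m l ∈ S i := hl ▸ hm'.2 i
        have hSil : S i = S l := hS.eq_of_not_reach hm (fun j hj => hreach i j hi hj) hli
        let e := Equiv.swap i l
        have hSe : ∀ a, S (e a) = S a := by
          intro a
          by_cases hai : a = i
          · subst hai; simp [e, hSil]
          · by_cases hal : a = l
            · subst hal; simp [e, hSil]
            · simp [e, Equiv.swap_apply_of_ne_of_ne hai hal]
        have hgraph : plantedGraph S m = plantedGraph S (m ∘ e) := by
          refine Prod.ext (funext fun x => funext fun y => propext ?_) (Finset.ext fun x => ?_)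
          · simp only [plantedGraph, Function.comp]
            rw [← e.exists_congr_right]
            simp only [hSe]
          · simp only [plantedGraph, Finset.mem_filter, Finset.mem_univ, true_and, Function.comp]
            rw [← e.forall_congr_right]
        rw [hgraph]
        refine ih _ (Finset.card_lt_card ?_)
          ⟨hm.1.comp e.injective, fun a => hSe a ▸ hm.2 (e a)⟩ hm' rfl
        rw [Finset.ssubset_iff_of_subset]
        · exact ⟨i, by simpa using hi, by simp [e, hl]⟩
        · intro a
          by_cases hai : a = i
          · subst hai; simp [e, hl]
          · by_cases hal : a = l
            · subst hal
              simp only [Finset.mem_filter, Finset.mem_univ, true_and]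
              exact fun _ h => hai (hm'.1 (h.symm.trans hl))
            · simp [e, Equiv.swap_apply_of_ne_of_ne hai hal]

end Connectivity

/-- (Main theorem)  Two planted graphs `(G,B)` and `(H,C)` on the same vertex set
have the same cotransversal matroid (exactly the same routable sets) if and only
if their saturations can be obtained from each other by a finite sequence of
swap operations. -/
theorem same_cotransversal_iff_swaps {V : Type*} [DecidableEq V] [Fintype V]
    (EG : V → V → Prop) (B : Finset V) (hG : IsPlanted EG B)
    (EH : V → V → Prop) (C : Finset V) (hH : IsPlanted EH C)
    (EGbar : V → V → Prop) (hGbar : IsSaturation EG B EGbar)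
    (EHbar : V → V → Prop) (hHbar : IsSaturation EH C EHbar) :
    (∀ A : Finset V, Routable EG B A ↔ Routable EH C A) ↔
    Relation.ReflTransGen (SwapStep (V := V)) (EGbar, B) (EHbar, C) := by
  have hplG := hGbar.2.1
  have hplH := hHbar.2.1
  have hG' := fun A => (hGbar.2.2.1 A).symm.trans (routable_iff_isTransversal_outFamily hplG A)
  have hH' := fun A => (hHbar.2.2.1 A).symm.trans (routable_iff_isTransversal_outFamily hplH A)
  have hm := isSDR_outFamily EGbar B
  have hm' := isSDR_outFamily EHbar C
  constructor
  · intro h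
    obtain ⟨e, he⟩ := exists_equiv_of_isMaximalFamily hm hm'
      (fun T => by rw [← compl_compl T, ← hG', ← hH', h]) hGbar.isMaximalFamily
      hHbar.isMaximalFamily
    have hme : IsSDR (outFamily EGbar B) (Subtype.val ∘ e) :=
      ⟨Subtype.val_injective.comp e.injective, fun i => he i ▸ hm'.2 (e i)⟩
    have hend : plantedGraph (outFamily EGbar B) (Subtype.val ∘ e) = (EHbar, C) := by
      rw [← plantedGraph_outFamily hplH]
      refine Prod.ext (funext fun x => funext fun y => propext ?_) (Finset.ext fun x => ?_)
      · simp only [plantedGraph, Function.comp, ← he]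
        exact e.exists_congr_right
          (q := fun i : {v // v ∉ C} => (i : V) = x ∧ y ∈ outFamily EHbar C i ∧ y ≠ x)
      · simp only [plantedGraph, Finset.mem_filter, Finset.mem_univ, true_and, Function.comp]
        exact e.forall_congr_right (q := fun i : {v // v ∉ C} => (i : V) ≠ x)
    have := hGbar.isMaximalFamily.reflTransGen_swapStep hm hme
    rwa [hend, plantedGraph_outFamily hplG] at this
  · intro h A
    have hinv : ∀ q, Relation.ReflTransGen SwapStep (EGbar, B) q →
        ∃ m, IsSDR (outFamily EGbar B) m ∧ q = plantedGraph (outFamily EGbar B) m := by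
      intro q hq
      induction hq with
      | refl => exact ⟨_, hm, (plantedGraph_outFamily hplG).symm⟩
      | tail _ hstep ih =>
        obtain ⟨m, hm, rfl⟩ := ih
        exact hstep.exists_isSDR hm
    obtain ⟨m, hm, hq⟩ := hinv _ h
    have := routable_plantedGraph_iff hm A
    rw [← hq] at this
    rw [hG', ← this, hHbar.2.2.1]
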